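/- For every real number p with 0 < p < 1/2, the Kullback–Leibler divergence between Bernoulli(2p) and Bernoulli(p) satisfies 2p·ln 2 + (1−2p)·ln((1−2p)/(1−p)) ≥ (2·ln 2 − 1)·p. -/

import Mathlib

/-- For `0 < p < 1/2`, the KL divergence between `Bernoulli(2p)` and `Bernoulli(p)` satisfies
`d(2p‖p) = 2p ln 2 + (1−2p) ln((1−2p)/(1−p)) ≥ (2 ln 2 − 1) p`. -/
theorem kl_two_p_lower_bound (p : ℝ) (hp0 : 0 < p) (hp : p < 1 / 2) :
    (2 * Real.log 2 - 1) * p ≤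
      2 * p * Real.log 2 + (1 - 2 * p) * Real.log ((1 - 2 * p) / (1 - p)) := by
  have h₁ : 0 < 1 - 2 * p := by linarith
  have h₂ : 0 < 1 - p := by linarith
  have h_log := mul_le_mul_of_nonneg_left (Real.one_sub_inv_le_log_of_pos (div_pos h₁ h₂)) h₁.le
  have h_eq : (1 - 2 * p) * (1 - ((1 - 2 * p) / (1 - p))⁻¹) = -p := by
    rw [inv_div, mul_sub, mul_div_cancel₀ _ h₁.ne']
    ring
  linarith
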